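/- arXiv:2506.19149 — 2 statements merged into one kernel-verified Lean document; each statement's English description precedes it below -/
import Mathlib

section
/- Let f(n) be the maximum of ι(G,P_3) over all connected n-vertex graphs G with no induced 6-cycles. Then f(n) = ⌊(n+1)/4⌋ for every n ≥ 1. -/
open SimpleGraph

/-- The closed neighbourhood `N[D]` of a set `D` of vertices in a graph `G`. -/
def closedNbhd {V : Type*} (G : SimpleGraph V) (D : Set V) : Set V :=
  D ∪ {v | ∃ d ∈ D, G.Adj d v}

/-- `G` contains a (not necessarily induced) copy of `H`. -/
def ContainsCopy {α β : Type*} (G : SimpleGraph α) (H : SimpleGraph β) : Prop :=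
  ∃ f : β ↪ α, ∀ a b, H.Adj a b → G.Adj (f a) (f b)

/-- `D` is a `P₃`-isolating set of `G`: `G − N[D]` contains no 3-vertex path. -/
def IsP3IsolatingSet {V : Type*} (G : SimpleGraph V) (D : Set V) : Prop :=
  ¬ ContainsCopy (SimpleGraph.induce (closedNbhd G D)ᶜ G) (SimpleGraph.pathGraph 3)

/-- The `P₃`-isolation number of `G`. -/
noncomputable def iotaP3 {V : Type*} (G : SimpleGraph V) : ℕ :=
  sInf {m | ∃ D : Set V, IsP3IsolatingSet G D ∧ D.ncard = m}

/-- `G` has an induced 6-cycle. -/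
def HasInducedC6 {V : Type*} (G : SimpleGraph V) : Prop :=
  ∃ f : Fin 6 ↪ V, ∀ a b, G.Adj (f a) (f b) ↔ (SimpleGraph.cycleGraph 6).Adj a b

/-- `f n` is the maximum of `ι(G, P₃)` over all connected `n`-vertex graphs `G`
with no induced 6-cycles. -/
noncomputable def fmax (n : ℕ) : ℕ :=
  sSup {m | ∃ G : SimpleGraph (Fin n), G.Connected ∧ ¬ HasInducedC6 G ∧ iotaP3 G = m}

set_option linter.all false

namespace P3

section Upper
variable {V : Type} [Fintype V] [DecidableEq V] (G : SimpleGraph V)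

/-- `v` lies in the closed neighbourhood of `D`. -/
def Dom (D : Finset V) (v : V) : Prop := v ∈ D ∨ ∃ d ∈ D, G.Adj d v

/-- `D` isolates the vertex set `A`. -/
def Isol (A D : Finset V) : Prop :=
  ∀ a ∈ A, ∀ b ∈ A, ∀ c ∈ A, ¬ Dom G D a → ¬ Dom G D b → ¬ Dom G D c →
    G.Adj a b → G.Adj b c → a = c

/-- The least size of a set isolating `A`. -/
noncomputable def io (A : Finset V) : ℕ := sInf {k | ∃ D, Isol G A D ∧ D.card = k}

/-- No edges between `B` and `C`. -/
def Sep (B C : Finset V) : Prop := ∀ b ∈ B, ∀ c ∈ C, ¬ G.Adj b c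

def Conn (C : Finset V) : Prop :=
  C.Nonempty ∧ ∀ B ⊆ C, B.Nonempty → Sep G B (C \ B) → B = C

def IsComp (A C : Finset V) : Prop := C ⊆ A ∧ Conn G C ∧ Sep G C (A \ C)

def Bad (C : Finset V) : Prop := Conn G C ∧ 4 * io G C = C.card + 1

open Classical in
noncomputable def bads (A : Finset V) : Finset (Finset V) :=
  A.powerset.filter (fun C => IsComp G A C ∧ Bad G C)

variable {G}

lemma io_spec (A : Finset V) : ∃ D, Isol G A D ∧ D.card = io G A := by
  have : {k | ∃ D, Isol G A D ∧ D.card = k}.Nonempty :=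
    ⟨A.card, A, fun a ha b hb c hc h => absurd (Or.inl ha) h, rfl⟩
  exact Nat.sInf_mem this

lemma io_le {A D : Finset V} (h : Isol G A D) : io G A ≤ D.card :=
  Nat.sInf_le ⟨D, h, rfl⟩

lemma Dom.mono {D E : Finset V} (h : D ⊆ E) {v : V} (hv : Dom G D v) : Dom G E v := by
  rcases hv with hv | ⟨d, hd, hv⟩
  · exact Or.inl (h hv)
  · exact Or.inr ⟨d, h hd, hv⟩

lemma io_mono {A B : Finset V} (h : A ⊆ B) : io G A ≤ io G B := by
  obtain ⟨D, hD, hc⟩ := io_spec (G := G) B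
  rw [← hc]
  exact io_le fun a ha b hb c hc => hD a (h ha) b (h hb) c (h hc)

lemma io_union {A B : Finset V} (h : Sep G A B) : io G (A ∪ B) ≤ io G A + io G B := by
  obtain ⟨D, hD, hDc⟩ := io_spec (G := G) A
  obtain ⟨E, hE, hEc⟩ := io_spec (G := G) B
  rw [← hDc, ← hEc]
  refine (io_le (D := D ∪ E) ?_).trans (Finset.card_union_le _ _)
  intro a ha b hb c hc na nb nc hab hbc
  have mD : ∀ {v}, ¬ Dom G (D ∪ E) v → ¬ Dom G D v :=
    fun hv h' => hv (h'.mono Finset.subset_union_left)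
  have mE : ∀ {v}, ¬ Dom G (D ∪ E) v → ¬ Dom G E v :=
    fun hv h' => hv (h'.mono Finset.subset_union_right)
  simp only [Finset.mem_union] at ha hb hc
  rcases hb with hb | hb
  · have ha' : a ∈ A := ha.resolve_right fun h' => h b hb a h' hab.symm
    have hc' : c ∈ A := hc.resolve_right fun h' => h b hb c h' hbc
    exact hD a ha' b hb c hc' (mD na) (mD nb) (mD nc) hab hbc
  · have ha' : a ∈ B := ha.resolve_left fun h' => h a h' b hb hab
    have hc' : c ∈ B := hc.resolve_left fun h' => h c h' b hb hbc.symm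
    exact hE a ha' b hb c hc' (mE na) (mE nb) (mE nc) hab hbc

lemma io_pick (A : Finset V) (x : V) (X : Finset V) (hX : ∀ y ∈ X, y = x ∨ G.Adj x y) :
    io G A ≤ 1 + io G (A \ X) := by
  obtain ⟨D, hD, hDc⟩ := io_spec (G := G) (A \ X)
  rw [← hDc]
  have h1 : (insert x D).card ≤ 1 + D.card := by
    have := Finset.card_insert_le x D
    omega
  refine (io_le ?_).trans h1
  intro a ha b hb c hc na nb nc hab hbc
  have m : ∀ {v}, ¬ Dom G (insert x D) v → ¬ Dom G D v :=
    fun hv h' => hv (h'.mono (Finset.subset_insert _ _))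
  have mX : ∀ {v}, v ∈ A → ¬ Dom G (insert x D) v → v ∈ A \ X := by
    intro v hv h'
    refine Finset.mem_sdiff.2 ⟨hv, fun hvX => h' ?_⟩
    rcases hX v hvX with rfl | h2
    · exact Or.inl (Finset.mem_insert_self _ _)
    · exact Or.inr ⟨x, Finset.mem_insert_self _ _, h2⟩
  exact hD a (mX ha na) b (mX hb nb) c (mX hc nc) (m na) (m nb) (m nc) hab hbc

lemma exists_comp {A : Finset V} {a : V} (ha : a ∈ A) : ∃ C, IsComp G A C ∧ a ∈ C := by
  classical
  let F := A.powerset.filter (fun B => a ∈ B ∧ Sep G B (A \ B))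
  have hF : F.Nonempty := ⟨A, by simp [F, ha, Sep]; tauto⟩
  obtain ⟨C, hC, hmin⟩ := Finset.exists_min_image F Finset.card hF
  simp only [F, Finset.mem_filter, Finset.mem_powerset] at hC hmin
  obtain ⟨hCA, haC, hsep⟩ := hC
  refine ⟨C, ⟨hCA, ⟨⟨a, haC⟩, ?_⟩, hsep⟩, haC⟩
  intro B hB hBn hs
  by_cases haB : a ∈ B
  · refine Finset.eq_of_subset_of_card_le hB (hmin B ⟨hB.trans hCA, haB, ?_⟩)
    intro b hb c hc hadj
    simp only [Finset.mem_sdiff] at hc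
    by_cases hcC : c ∈ C
    · exact hs b hb c (Finset.mem_sdiff.2 ⟨hcC, hc.2⟩) hadj
    · exact hsep b (hB hb) c (Finset.mem_sdiff.2 ⟨hc.1, hcC⟩) hadj
  · exfalso
    have h1 := hmin (C \ B) ⟨Finset.sdiff_subset.trans hCA, Finset.mem_sdiff.2 ⟨haC, haB⟩, ?_⟩
    · have h2 := Finset.card_sdiff_add_card_eq_card hB
      have h3 := hBn.card_pos
      omega
    intro b hb c hc hadj
    simp only [Finset.mem_sdiff, not_and, not_not] at hc hb
    by_cases hcC : c ∈ C
    · exact hs c (hc.2 hcC) b (Finset.mem_sdiff.2 hb) hadj.symm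
    · exact hsep b hb.1 c (Finset.mem_sdiff.2 ⟨hc.1, hcC⟩) hadj

/-- A proper nonempty part of a connected set is left by an edge. -/
lemma Conn.edge {C B : Finset V} (hC : Conn G C) (hB : B ⊆ C) (hn : B.Nonempty) (hne : B ≠ C) :
    ∃ b ∈ B, ∃ c ∈ C, c ∉ B ∧ G.Adj b c := by
  by_contra hcon
  push Not at hcon
  exact hne (hC.2 B hB hn fun b hb c hc =>
    hcon b hb c (Finset.mem_sdiff.1 hc).1 (Finset.mem_sdiff.1 hc).2)

lemma Conn.subset_comp {A C K : Finset V} (hC : Conn G C) (hCA : C ⊆ A) (hK : IsComp G A K)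
    {a : V} (haC : a ∈ C) (haK : a ∈ K) : C ⊆ K := by
  have : C ∩ K = C := by
    refine hC.2 _ Finset.inter_subset_left ⟨a, Finset.mem_inter.2 ⟨haC, haK⟩⟩ ?_
    intro b hb c hc
    simp only [Finset.mem_inter, Finset.mem_sdiff] at hb hc
    exact hK.2.2 b hb.2 c (Finset.mem_sdiff.2 ⟨hCA hc.1, fun h => hc.2 ⟨hc.1, h⟩⟩)
  exact Finset.inter_eq_left.1 this

lemma IsComp.eq {A C K : Finset V} (hC : IsComp G A C) (hK : IsComp G A K)
    {a : V} (haC : a ∈ C) (haK : a ∈ K) : C = K :=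
  (hC.2.1.subset_comp hC.1 hK haC haK).antisymm (hK.2.1.subset_comp hK.1 hC haK haC)

lemma mem_bads {A C : Finset V} : C ∈ bads G A ↔ IsComp G A C ∧ Bad G C := by
  classical
  simp only [bads, Finset.mem_filter, Finset.mem_powerset]
  exact ⟨fun h => h.2, fun h => ⟨h.1.1, h⟩⟩

lemma comp_sdiff {A C K : Finset V} (hK : IsComp G A K) :
    IsComp G (A \ K) C ↔ IsComp G A C ∧ C ≠ K := by
  constructor
  · rintro ⟨h1, h2, h3⟩
    refine ⟨⟨h1.trans Finset.sdiff_subset, h2, ?_⟩, ?_⟩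
    · intro b hb c hc
      simp only [Finset.mem_sdiff] at hc
      by_cases hcK : c ∈ K
      · intro hadj
        exact hK.2.2 c hcK b (h1 hb) hadj.symm
      · exact h3 b hb c (by simp [hc, hcK])
    · rintro rfl
      obtain ⟨a, ha⟩ := h2.1
      exact (Finset.mem_sdiff.1 (h1 ha)).2 ha
  · rintro ⟨h, hne⟩
    have hd : ∀ a ∈ C, a ∉ K := fun a ha haK => hne (h.eq hK ha haK)
    refine ⟨fun a ha => Finset.mem_sdiff.2 ⟨h.1 ha, hd a ha⟩, h.2.1, ?_⟩
    intro b hb c hc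
    simp only [Finset.mem_sdiff] at hc
    exact h.2.2 b hb c (by simp [hc])

open Classical in
/-- Main summation over components: every bad component met by `Z` gains `4`. -/
lemma sum_comp
    (hsm : ∀ C : Finset V, Conn G C → C ≠ Finset.univ → 4 * io G C ≤ C.card + 1)
    (Z : Finset V) :
    ∀ (m : ℕ) (A : Finset V), A.card = m → A ≠ Finset.univ →
    (∀ C ∈ bads G A, ∀ z ∈ C, 4 * io G (C.erase z) + 3 ≤ C.card) →
    4 * io G (A \ Z) + 4 * ((bads G A).filter (fun C => ∃ z ∈ C, z ∈ Z)).card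
      ≤ A.card + (bads G A).card := by
  intro m
  induction m using Nat.strong_induction_on with
  | _ m ih =>
  intro A hAm hA hL
  rcases A.eq_empty_or_nonempty with rfl | ⟨a, ha⟩
  · have h0 : io G (∅ \ Z) = 0 := by
      have := io_le (G := G) (A := ∅ \ Z) (D := ∅) (by intro a ha; simp at ha)
      simpa using this
    have : bads G (∅ : Finset V) = ∅ := by
      ext C
      simp only [mem_bads, Finset.notMem_empty, iff_false]
      rintro ⟨⟨h, hc, -⟩, -⟩
      obtain ⟨a, ha⟩ := hc.1
      simpa using h ha
    rw [h0, this]; simp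
  obtain ⟨K, hK, haK⟩ := exists_comp (G := G) ha
  have hKu : K ≠ Finset.univ := fun h => hA (Finset.eq_univ_iff_forall.2 fun x =>
    hK.1 (h ▸ Finset.mem_univ x))
  have hcard : (A \ K).card + K.card = A.card := Finset.card_sdiff_add_card_eq_card hK.1
  have hKpos : 0 < K.card := Finset.card_pos.2 ⟨a, haK⟩
  have hbad : ∀ C, C ∈ bads G (A \ K) ↔ C ∈ bads G A ∧ C ≠ K := by
    intro C
    rw [mem_bads, mem_bads, comp_sdiff hK]
    tauto
  have hb : bads G (A \ K) = (bads G A).erase K := by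
    ext C
    rw [hbad, Finset.mem_erase]
    tauto
  have ih' := ih (A \ K).card (by omega) (A \ K) rfl
    (fun h => by
      have : a ∈ A \ K := h ▸ Finset.mem_univ a
      simp [haK] at this)
    (fun C hC => hL C ((hbad C).1 hC).1)
  have hsplit : io G (A \ Z) ≤ io G (K \ Z) + io G ((A \ K) \ Z) := by
    have : A \ Z = (K \ Z) ∪ ((A \ K) \ Z) := by
      ext x
      have := @hK.1 x
      simp only [Finset.mem_sdiff, Finset.mem_union]
      tauto
    rw [this]
    refine io_union ?_
    intro b hb c hc
    exact hK.2.2 b (Finset.mem_sdiff.1 hb).1 c (Finset.mem_sdiff.1 hc).1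
  rw [hb, Finset.filter_erase] at ih'
  have hKZ : io G (K \ Z) ≤ io G K := io_mono Finset.sdiff_subset
  have hKs := hsm K hK.2.1 hKu
  by_cases hKb : K ∈ bads G A
  · have e1 := Finset.card_erase_add_one hKb
    by_cases hz : ∃ z ∈ K, z ∈ Z
    · have hf : K ∈ (bads G A).filter (fun C => ∃ z ∈ C, z ∈ Z) :=
        Finset.mem_filter.2 ⟨hKb, hz⟩
      have e2 := Finset.card_erase_add_one hf
      obtain ⟨z, hzK, hzZ⟩ := hz
      have h5 := hL K hKb z hzK
      have h6 : io G (K \ Z) ≤ io G (K.erase z) := io_mono (by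
        intro x hx
        simp only [Finset.mem_sdiff] at hx
        exact Finset.mem_erase.2 ⟨fun h => hx.2 (h ▸ hzZ), hx.1⟩)
      omega
    · rw [Finset.erase_eq_of_notMem (s := (bads G A).filter (fun C => ∃ z ∈ C, z ∈ Z))
        (fun h => hz (Finset.mem_filter.1 h).2)] at ih'
      omega
  · have hKs' : 4 * io G K ≤ K.card := by
      have : ¬ 4 * io G K = K.card + 1 := fun h => hKb (mem_bads.2 ⟨hK, hK.2.1, h⟩)
      omega
    rw [Finset.erase_eq_of_notMem hKb, Finset.erase_eq_of_notMem (s := (bads G A).filter (fun C => ∃ z ∈ C, z ∈ Z))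
        (fun h => hKb (Finset.mem_filter.1 h).1)] at ih'
    omega

open Classical in
lemma no_bads
    (hsm : ∀ C : Finset V, Conn G C → C ≠ Finset.univ → 4 * io G C ≤ C.card + 1)
    {K : Finset V} (hK : Conn G K) (hKc : K.card + 1 ≤ 4 * io G K) {w : V} (hw : w ∈ K)
    (hL : ∀ C ∈ bads G (K.erase w), ∀ z ∈ C, 4 * io G (C.erase z) + 3 ≤ C.card) :
    bads G (K.erase w) = ∅ := by
  set Z : Finset V := Finset.univ.filter (fun z => G.Adj w z) with hZ
  have hAu : K.erase w ≠ Finset.univ := fun h => by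
    have := Finset.mem_univ w
    rw [← h] at this
    simp at this
  have h1 := sum_comp hsm Z _ (K.erase w) rfl hAu hL
  have hall : (bads G (K.erase w)).filter (fun C => ∃ z ∈ C, z ∈ Z) = bads G (K.erase w) := by
    refine Finset.filter_true_of_mem ?_
    intro C hC
    obtain ⟨hC1, hC2⟩ := mem_bads.1 hC
    have hwC : w ∉ C := fun h => by simpa using hC1.1 h
    obtain ⟨b, hb, c, hc, hcC, hadj⟩ := hK.edge (hC1.1.trans (Finset.erase_subset _ _))
      hC1.2.1.1 (fun h => hwC (h ▸ hw))
    have hcw : c = w := by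
      by_contra hcw
      exact hC1.2.2 b hb c (by simp [hc, hcC, hcw]) hadj
    subst hcw
    exact ⟨b, hb, by simp [hZ, hadj.symm]⟩
  rw [hall] at h1
  have h2 := io_pick (G := G) K w (insert w Z) (by
    intro y hy
    simpa [hZ] using hy)
  have h3 : K \ insert w Z = K.erase w \ Z := by
    ext y
    simp only [Finset.mem_sdiff, Finset.mem_insert, Finset.mem_erase]
    tauto
  rw [h3] at h2
  have h4 := Finset.card_erase_add_one hw
  rw [← Finset.card_eq_zero]
  omega

lemma bad_erase
    (hsm : ∀ C : Finset V, Conn G C → C ≠ Finset.univ → 4 * io G C ≤ C.card + 1) :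
    ∀ (m : ℕ) (K : Finset V), K.card = m → K ≠ Finset.univ → Bad G K → ∀ w ∈ K,
      bads G (K.erase w) = ∅ ∧ 4 * io G (K.erase w) + 3 ≤ K.card := by
  classical
  intro m
  induction m using Nat.strong_induction_on with
  | _ m ih =>
  intro K hKm hKu hKb w hw
  have h4 := Finset.card_erase_add_one hw
  have hAu : K.erase w ≠ Finset.univ := fun h => by
    have := Finset.mem_univ w
    rw [← h] at this
    simp at this
  have hL : ∀ C ∈ bads G (K.erase w), ∀ z ∈ C, 4 * io G (C.erase z) + 3 ≤ C.card := by
    intro C hC z hz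
    obtain ⟨hC1, hC2⟩ := mem_bads.1 hC
    have h5 := Finset.card_le_card hC1.1
    refine (ih C.card (by omega) C rfl ?_ hC2 z hz).2
    intro h
    exact hAu (Finset.eq_univ_iff_forall.2 fun x => hC1.1 (h ▸ Finset.mem_univ x))
  have h1 := no_bads hsm hKb.1 hKb.2.symm.le hw hL
  refine ⟨h1, ?_⟩
  have h2 := sum_comp hsm ∅ _ (K.erase w) rfl hAu hL
  rw [h1] at h2
  simp at h2
  have := hKb.2
  omega

/-- A minimal counterexample. -/
structure Ctr (G : SimpleGraph V) : Prop where
  conn : Conn G Finset.univ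
  big : Fintype.card V + 2 ≤ 4 * io G (Finset.univ : Finset V)
  small : ∀ C : Finset V, Conn G C → C ≠ Finset.univ → 4 * io G C ≤ C.card + 1

open Classical in
lemma Ctr.sum (h : Ctr G) (Z A : Finset V) (hA : A ≠ Finset.univ) :
    4 * io G (A \ Z) + 4 * ((bads G A).filter (fun C => ∃ z ∈ C, z ∈ Z)).card
      ≤ A.card + (bads G A).card := by
  refine sum_comp h.small Z _ A rfl hA ?_
  intro C hC z hz
  obtain ⟨hC1, hC2⟩ := mem_bads.1 hC
  exact (bad_erase h.small _ C rfl (fun h => hA (Finset.eq_univ_iff_forall.2 fun x =>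
    hC1.1 (h ▸ Finset.mem_univ x))) hC2 z hz).2

/-- Deleting one vertex leaves no bad component. -/
lemma Ctr.one (h : Ctr G) (x : V) : bads G (Finset.univ.erase x) = ∅ := by
  refine no_bads h.small h.conn ?_ (Finset.mem_univ x) ?_
  · have := h.big
    rw [Finset.card_univ]
    omega
  intro C hC z hz
  obtain ⟨hC1, hC2⟩ := mem_bads.1 hC
  refine (bad_erase h.small _ C rfl (fun h => ?_) hC2 z hz).2
  have := hC1.1 (h ▸ Finset.mem_univ x)
  simp at this

lemma Ctr.bad_erase (h : Ctr G) {K : Finset V} (hK : K ≠ Finset.univ) (hb : Bad G K) {w : V}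
    (hw : w ∈ K) : bads G (K.erase w) = ∅ :=
  (P3.bad_erase h.small _ K rfl hK hb w hw).1

/-- Picking `x` and deleting `X ⊆ N[x]`. -/
lemma Ctr.pick (h : Ctr G) (x : V) (X : Finset V) (hx : x ∈ X)
    (hX : ∀ y ∈ X, y = x ∨ G.Adj x y) :
    X.card ≤ (bads G (Finset.univ \ X)).card + 2 := by
  classical
  have h1 := io_pick (G := G) Finset.univ x X hX
  have h2 := h.sum ∅ (Finset.univ \ X) (fun h => by
    have := Finset.mem_univ x
    rw [← h] at this
    simp [hx] at this)
  simp at h2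
  have h3 := h.big
  have h4 := Finset.card_sdiff_add_card_eq_card (Finset.subset_univ X)
  rw [Finset.card_univ] at h4
  omega

/-- The deletion of the closed neighbourhood. -/
noncomputable def far (G : SimpleGraph V) (v : V) : Finset V :=
  by classical exact Finset.univ.filter (fun z => z ≠ v ∧ ¬ G.Adj v z)

lemma mem_far {v z : V} : z ∈ far G v ↔ z ≠ v ∧ ¬ G.Adj v z := by
  classical
  simp [far]

/-- Every bad component of `G - N[v]` is touched twice. -/
lemma Ctr.touch_two (h : Ctr G) {v : V} {H : Finset V} (hH : H ∈ bads G (far G v)) (x : V) :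
    ∃ x', x' ≠ x ∧ G.Adj v x' ∧ ∃ y ∈ H, G.Adj x' y := by
  obtain ⟨hH1, hH2⟩ := mem_bads.1 hH
  by_contra hcon
  push Not at hcon
  have key : ∀ b ∈ H, ∀ c, c ∉ H → G.Adj b c → c = x ∧ G.Adj v c := by
    intro b hb c hc hadj
    have hcv : G.Adj v c := by
      by_contra hcv
      refine hH1.2.2 b hb c (Finset.mem_sdiff.2 ⟨mem_far.2 ⟨?_, hcv⟩, hc⟩) hadj
      rintro rfl
      exact (mem_far.1 (hH1.1 hb)).2 hadj.symm
    refine ⟨?_, hcv⟩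
    by_contra hcx
    exact hcon c hcx hcv b hb hadj.symm
  have hvH : v ∉ H := fun h' => (mem_far.1 (hH1.1 h')).1 rfl
  obtain ⟨b, hb, c, -, hc, hadj⟩ := h.conn.edge (Finset.subset_univ H) hH1.2.1.1
    (fun h' => hvH (h' ▸ Finset.mem_univ v))
  obtain ⟨rfl, hvc⟩ := key b hb c hc hadj
  have : H ∈ bads G (Finset.univ.erase c) := by
    refine mem_bads.2 ⟨⟨?_, hH1.2.1, ?_⟩, hH2⟩
    · intro z hz
      simp only [Finset.mem_erase, Finset.mem_univ, and_true]
      rintro rfl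
      exact hc hz
    · intro p hp q hq hpq
      simp only [Finset.mem_sdiff, Finset.mem_erase, Finset.mem_univ, and_true] at hq
      exact hq.1 (key p hp q hq.2 hpq).1
  rw [h.one] at this
  simp at this

/-- No neighbour of `v` touches two bad components of `G - N[v]`. -/
lemma Ctr.touch_one (h : Ctr G) {v x : V} (hvx : G.Adj v x) {H₁ H₂ : Finset V}
    (hH₁ : H₁ ∈ bads G (far G v)) (hH₂ : H₂ ∈ bads G (far G v))
    {y₁ y₂ : V} (hy₁ : y₁ ∈ H₁) (hy₂ : y₂ ∈ H₂) (hxy₁ : G.Adj x y₁) (hxy₂ : G.Adj x y₂) :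
    H₁ = H₂ := by
  classical
  by_contra hne
  obtain ⟨hc₁, hb₁⟩ := mem_bads.1 hH₁
  obtain ⟨hc₂, hb₂⟩ := mem_bads.1 hH₂
  have hf₁ := mem_far.1 (hc₁.1 hy₁)
  have hf₂ := mem_far.1 (hc₂.1 hy₂)
  have hyy : y₁ ≠ y₂ := fun h' => hne (hc₁.eq hc₂ hy₁ (h' ▸ hy₂))
  set X : Finset V := {x, y₁, y₂} with hXdef
  have hXc : X.card = 3 := by
    rw [hXdef, Finset.card_eq_three]
    exact ⟨x, y₁, y₂, hxy₁.ne, hxy₂.ne, hyy, rfl⟩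
  have hXx : ∀ y ∈ X, y = x ∨ G.Adj x y := by
    intro y hy
    simp only [hXdef, Finset.mem_insert, Finset.mem_singleton] at hy
    rcases hy with rfl | rfl | rfl <;> simp [*]
  have hxX : x ∈ X := by simp [hXdef]
  set A : Finset V := Finset.univ \ X with hA
  have hmA : ∀ z, z ∈ A ↔ z ≠ x ∧ z ≠ y₁ ∧ z ≠ y₂ := by
    intro z
    simp [hA, hXdef]
  have hAu : A ≠ Finset.univ := fun h => by
    have := Finset.mem_univ x
    rw [← h, hmA] at this
    exact this.1 rfl
  -- every bad component contains v
  have hv : ∀ C ∈ bads G A, v ∈ C := by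
    intro C hC
    obtain ⟨hCc, hCb⟩ := mem_bads.1 hC
    by_contra hvC
    have hvA : v ∈ A := (hmA v).2 ⟨hvx.ne, hf₁.1.symm, hf₂.1.symm⟩
    have hCfar : C ⊆ far G v := by
      intro z hz
      refine mem_far.2 ⟨fun h' => hvC (h' ▸ hz), fun hadj => ?_⟩
      exact hCc.2.2 z hz v (Finset.mem_sdiff.2 ⟨hvA, hvC⟩) hadj.symm
    -- neighbours of C lie in X
    have hN : ∀ z ∈ C, ∀ q, q ∉ C → G.Adj z q → q = x ∨ q = y₁ ∨ q = y₂ := by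
      intro z hz q hq hadj
      by_contra hcon
      push Not at hcon
      exact hCc.2.2 z hz q (Finset.mem_sdiff.2 ⟨(hmA q).2 hcon, hq⟩) hadj
    have aux : ∀ (H : Finset V) (y : V), H ∈ bads G (far G v) → y ∈ H → (y = y₁ ∨ y = y₂) →
        (∀ y', (y' = y₁ ∨ y' = y₂) → y' ∈ H → y' = y) → ∀ z ∈ C, z ∉ H := by
      intro H y hH hyH hy huniq z hzC hzH
      obtain ⟨hHc, hHb⟩ := mem_bads.1 hH
      have hCH := hCc.2.1.subset_comp hCfar hHc hzC hzH
      have hHu : H ≠ Finset.univ := fun h' =>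
        (mem_far.1 (hHc.1 (h' ▸ Finset.mem_univ v))).1 rfl
      have : C ∈ bads G (H.erase y) := by
        refine mem_bads.2 ⟨⟨?_, hCc.2.1, ?_⟩, hCb⟩
        · intro t ht
          refine Finset.mem_erase.2 ⟨?_, hCH ht⟩
          have := (hmA t).1 (hCc.1 ht)
          rintro rfl
          tauto
        · intro p hp q hq hpq
          simp only [Finset.mem_sdiff, Finset.mem_erase] at hq
          rcases hN p hp q hq.2 hpq with rfl | hq'
          · exact (mem_far.1 (hHc.1 hq.1.2)).2 hvx
          · exact hq.1.1 (huniq q hq' hq.1.2)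
      rw [h.bad_erase hHu hHb hyH] at this
      simp at this
    have n₁ := aux H₁ y₁ hH₁ hy₁ (Or.inl rfl) (by
      rintro y' (rfl | rfl) hy'
      · rfl
      · exact absurd (hc₁.eq hc₂ hy' hy₂) hne)
    have n₂ := aux H₂ y₂ hH₂ hy₂ (Or.inr rfl) (by
      rintro y' (rfl | rfl) hy'
      · exact absurd (hc₁.eq hc₂ hy₁ hy') hne
      · rfl)
    have : C ∈ bads G (Finset.univ.erase x) := by
      refine mem_bads.2 ⟨⟨?_, hCc.2.1, ?_⟩, hCb⟩
      · intro t ht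
        exact Finset.mem_erase.2 ⟨((hmA t).1 (hCc.1 ht)).1, Finset.mem_univ _⟩
      · intro p hp q hq hpq
        simp only [Finset.mem_sdiff, Finset.mem_erase, Finset.mem_univ, and_true] at hq
        rcases hN p hp q hq.2 hpq with h' | rfl | rfl
        · exact hq.1 h'
        · exact hc₁.2.2 q hy₁ p (Finset.mem_sdiff.2 ⟨hCfar hp, n₁ p hp⟩) hpq.symm
        · exact hc₂.2.2 q hy₂ p (Finset.mem_sdiff.2 ⟨hCfar hp, n₂ p hp⟩) hpq.symm
    rw [h.one] at this
    simp at this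
  have hle : (bads G A).card ≤ 1 := by
    refine Finset.card_le_one.2 fun C hC C' hC' => ?_
    exact (mem_bads.1 hC).1.eq (mem_bads.1 hC').1 (hv C hC) (hv C' hC')
  set Z : Finset V := Finset.univ.filter (fun z => G.Adj x z) with hZ
  have h1 := h.sum Z A hAu
  have hall : (bads G A).filter (fun C => ∃ z ∈ C, z ∈ Z) = bads G A := by
    refine Finset.filter_true_of_mem fun C hC => ⟨v, hv C hC, ?_⟩
    simp [hZ, hvx.symm]
  rw [hall] at h1
  have h2 := io_pick (G := G) Finset.univ x (X ∪ Z) (by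
    intro y hy
    rcases Finset.mem_union.1 hy with hy | hy
    · exact hXx y hy
    · right
      simpa [hZ] using hy)
  have h3 : Finset.univ \ (X ∪ Z) = A \ Z := by
    rw [hA]
    ext z
    simp only [Finset.mem_sdiff, Finset.mem_union]
    tauto
  rw [h3] at h2
  have h4 := Finset.card_sdiff_add_card_eq_card (Finset.subset_univ X)
  rw [Finset.card_univ, ← hA] at h4
  have h5 := h.big
  omega

/-- All degrees are at most two. -/
lemma Ctr.deg (h : Ctr G) (v : V) {a b c : V} (ha : G.Adj v a) (hb : G.Adj v b)
    (hab : a ≠ b) (hc : G.Adj v c) : c = a ∨ c = b := by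
  classical
  by_contra hcon
  push Not at hcon
  set N : Finset V := Finset.univ.filter (fun z => G.Adj v z) with hN
  have hN3 : 3 ≤ N.card := by
    have : ({a, b, c} : Finset V).card = 3 := by
      rw [Finset.card_eq_three]
      exact ⟨a, b, c, hab, hcon.1.symm, hcon.2.symm, rfl⟩
    rw [← this]
    refine Finset.card_le_card ?_
    intro z hz
    simp only [Finset.mem_insert, Finset.mem_singleton] at hz
    rcases hz with rfl | rfl | rfl <;> simp [hN, *]
  have h1 := h.pick v (insert v N) (Finset.mem_insert_self _ _) (by
    intro y hy
    simpa [hN] using hy)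
  have hvN : v ∉ N := by simp [hN]
  rw [Finset.card_insert_of_notMem hvN] at h1
  have hfar : Finset.univ \ insert v N = far G v := by
    ext z
    simp [hN, mem_far]
  rw [hfar] at h1
  let T : Finset V → Finset V := fun H => N.filter (fun x => ∃ y ∈ H, G.Adj x y)
  have hT2 : ∀ H ∈ bads G (far G v), 2 ≤ (T H).card := by
    intro H hH
    obtain ⟨x, -, hx, hxy⟩ := h.touch_two hH v
    obtain ⟨x', hne, hx', hxy'⟩ := h.touch_two hH x
    have : 1 < (T H).card := Finset.one_lt_card.2
      ⟨x, by simp only [T, hN, Finset.mem_filter, Finset.mem_univ, true_and]; exact ⟨hx, hxy⟩,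
       x', by simp only [T, hN, Finset.mem_filter, Finset.mem_univ, true_and]; exact ⟨hx', hxy'⟩,
       hne.symm⟩
    omega
  have hdisj : ((bads G (far G v) : Finset (Finset V)) : Set (Finset V)).PairwiseDisjoint T := by
    intro H hH H' hH' hne
    refine Finset.disjoint_left.2 fun x hx hx' => hne ?_
    simp only [T, hN, Finset.mem_filter, Finset.mem_univ, true_and] at hx hx'
    obtain ⟨hvx, y, hy, hxy⟩ := hx
    obtain ⟨-, y', hy', hxy'⟩ := hx'
    exact h.touch_one hvx hH hH' hy hy' hxy hxy'
  have h2 := Finset.card_nsmul_le_sum (bads G (far G v)) (fun H => (T H).card) 2 hT2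
  rw [← Finset.card_biUnion hdisj] at h2
  have h3 : ((bads G (far G v)).biUnion T).card ≤ N.card :=
    Finset.card_le_card (Finset.biUnion_subset.2 fun H _ => Finset.filter_subset _ _)
  simp only [smul_eq_mul] at h2
  omega

/-- A minimal counterexample is a 6-cycle. -/
lemma Ctr.six (h : Ctr G) : ∃ p₀ p₁ p₂ p₃ p₄ p₅ : V, [p₀, p₁, p₂, p₃, p₄, p₅].Nodup ∧
    G.Adj p₀ p₁ ∧ G.Adj p₁ p₂ ∧ G.Adj p₂ p₃ ∧ G.Adj p₃ p₄ ∧ G.Adj p₄ p₅ ∧ G.Adj p₅ p₀ := by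
  classical
  obtain ⟨a, v, c, hav, hvc, hac⟩ : ∃ a v c, G.Adj a v ∧ G.Adj v c ∧ a ≠ c := by
    by_contra hcon
    push Not at hcon
    have h1 : io G (Finset.univ : Finset V) ≤ (∅ : Finset V).card :=
      io_le fun a _ b _ c _ _ _ _ h1 h2 => hcon a b c h1 h2
    have := h.big
    simp at h1
    omega
  have hva := hav.symm
  have hX := h.pick v {v, a, c} (by simp) (by
    intro y hy
    simp only [Finset.mem_insert, Finset.mem_singleton] at hy
    rcases hy with rfl | rfl | rfl <;> simp [*])
  have hX3 : ({v, a, c} : Finset V).card = 3 := by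
    rw [Finset.card_eq_three]
    exact ⟨v, a, c, hva.ne, hvc.ne, hac, rfl⟩
  have hfar : Finset.univ \ {v, a, c} = far G v := by
    ext z
    simp only [Finset.mem_sdiff, Finset.mem_univ, true_and, Finset.mem_insert,
      Finset.mem_singleton, mem_far]
    constructor
    · intro hz
      refine ⟨fun h' => hz (Or.inl h'), fun h' => hz (Or.inr (h.deg v hva hvc hac h'))⟩
    · rintro ⟨h1, h2⟩ (rfl | rfl | rfl)
      · exact h1 rfl
      · exact h2 hva
      · exact h2 hvc
  rw [hX3, hfar] at hX
  obtain ⟨H, hH⟩ : (bads G (far G v)).Nonempty := by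
    rw [← Finset.card_pos]
    omega
  obtain ⟨hHc, hHb⟩ := mem_bads.1 hH
  have hvH : v ∉ H := fun h' => (mem_far.1 (hHc.1 h')).1 rfl
  have haH : a ∉ H := fun h' => (mem_far.1 (hHc.1 h')).2 hva
  have hcH : c ∉ H := fun h' => (mem_far.1 (hHc.1 h')).2 hvc
  obtain ⟨p₁, hp₁, hap₁⟩ : ∃ y ∈ H, G.Adj a y := by
    obtain ⟨x, hx, hvx, hy⟩ := h.touch_two hH c
    rcases h.deg v hva hvc hac hvx with rfl | rfl
    · exact hy
    · exact absurd rfl hx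
  obtain ⟨q, hq, hcq⟩ : ∃ y ∈ H, G.Adj c y := by
    obtain ⟨x, hx, hvx, hy⟩ := h.touch_two hH a
    rcases h.deg v hva hvc hac hvx with rfl | rfl
    · exact absurd rfl hx
    · exact hy
  have hHe := hHb.2
  have ne_card : ∀ {B : Finset V}, B.card < H.card → B ≠ H := fun h' h'' => by
    rw [h''] at h'
    omega
  have hHpos : 0 < H.card := Finset.card_pos.2 ⟨_, hp₁⟩
  have nea : ∀ {z}, z ∈ H → z ≠ a := fun hz h' => haH (h' ▸ hz)
  have nec : ∀ {z}, z ∈ H → z ≠ c := fun hz h' => hcH (h' ▸ hz)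
  have nev : ∀ {z}, z ∈ H → z ≠ v := fun hz h' => hvH (h' ▸ hz)
  -- p₂
  obtain ⟨p₂, hp₂, hp₁₂⟩ : ∃ p₂ ∈ H, G.Adj p₁ p₂ := by
    obtain ⟨b, hb, z, hz, -, hadj⟩ := hHc.2.1.edge (B := {p₁}) (by simpa using hp₁) (by simp)
      (ne_card (by rw [Finset.card_singleton]; omega))
    rw [Finset.mem_singleton] at hb
    exact ⟨z, hz, hb ▸ hadj⟩
  have d₁ : ∀ {z}, G.Adj p₁ z → z = a ∨ z = p₂ := fun hz =>
    h.deg p₁ hap₁.symm hp₁₂ (nea hp₂).symm hz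
  -- p₃
  obtain ⟨p₃, hp₃, hp₃₁, hp₂₃⟩ : ∃ p₃ ∈ H, p₃ ≠ p₁ ∧ G.Adj p₂ p₃ := by
    obtain ⟨b, hb, z, hz, hzB, hadj⟩ := hHc.2.1.edge (B := {p₁, p₂})
      (by intro t ht; simp at ht; rcases ht with rfl | rfl <;> assumption) (by simp)
      (ne_card (by have := Finset.card_le_two (a := p₁) (b := p₂); omega))
    simp only [Finset.mem_insert, Finset.mem_singleton, not_or] at hb hzB
    rcases hb with rfl | rfl
    · rcases d₁ hadj with rfl | rfl
      · exact absurd hz haH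
      · exact absurd rfl hzB.2
    · exact ⟨z, hz, hzB.1, hadj⟩
  have d₂ : ∀ {z}, G.Adj p₂ z → z = p₁ ∨ z = p₃ := fun hz =>
    h.deg p₂ hp₁₂.symm hp₂₃ hp₃₁.symm hz
  have hq₁ : q ≠ p₁ := by
    rintro rfl
    rcases d₁ hcq.symm with h' | h'
    · exact hac h'.symm
    · exact nec hp₂ h'.symm
  have hq₂ : q ≠ p₂ := by
    rintro rfl
    rcases d₂ hcq.symm with h' | h'
    · exact nec hp₁ h'.symm
    · exact nec hp₃ h'.symm
  have c3 : ({p₁, p₂, p₃} : Finset V).card = 3 := by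
    rw [Finset.card_eq_three]
    exact ⟨p₁, p₂, p₃, hp₁₂.ne, hp₃₁.symm, hp₂₃.ne, rfl⟩
  have s3 : ({p₁, p₂, p₃} : Finset V) ⊆ H := by
    intro t ht
    simp at ht
    rcases ht with rfl | rfl | rfl <;> assumption
  by_cases h3 : H.card = 3
  · have hHeq : ({p₁, p₂, p₃} : Finset V) = H :=
      Finset.eq_of_subset_of_card_le s3 (by omega)
    have hq3 : q = p₃ := by
      rw [← hHeq] at hq
      simp only [Finset.mem_insert, Finset.mem_singleton] at hq
      tauto
    subst hq3
    refine ⟨v, a, p₁, p₂, q, c, ?_, hva, hap₁, hp₁₂, hp₂₃, hcq.symm, hvc.symm⟩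
    simp only [List.nodup_cons, List.mem_cons, List.not_mem_nil, or_false, not_or]
    refine ⟨⟨hva.ne, (nev hp₁).symm, (nev hp₂).symm, (nev hp₃).symm, hvc.ne⟩,
      ⟨(nea hp₁).symm, (nea hp₂).symm, (nea hp₃).symm, hac⟩,
      ⟨hp₁₂.ne, hp₃₁.symm, nec hp₁⟩, ⟨hp₂₃.ne, nec hp₂⟩, nec hp₃, ?_⟩
    simp
  exfalso
  have h7 : 7 ≤ H.card := by
    have := Finset.card_le_card s3
    omega
  obtain ⟨p₄, hp₄, hp₄₂, hp₃₄⟩ : ∃ p₄ ∈ H, p₄ ≠ p₂ ∧ G.Adj p₃ p₄ := by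
    obtain ⟨b, hb, z, hz, hzB, hadj⟩ := hHc.2.1.edge s3 (by simp) (ne_card (by omega))
    simp only [Finset.mem_insert, Finset.mem_singleton, not_or] at hb hzB
    rcases hb with rfl | rfl | rfl
    · rcases d₁ hadj with rfl | rfl
      · exact absurd hz haH
      · exact absurd rfl hzB.2.1
    · rcases d₂ hadj with rfl | rfl
      · exact absurd rfl hzB.1
      · exact absurd rfl hzB.2.2
    · exact ⟨z, hz, hzB.2.1, hadj⟩
  have d₃ : ∀ {z}, G.Adj p₃ z → z = p₂ ∨ z = p₄ := fun hz =>
    h.deg p₃ hp₂₃.symm hp₃₄ hp₄₂.symm hz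
  have s4 : ({p₁, p₂, p₃, p₄} : Finset V) ⊆ H := by
    intro t ht
    simp at ht
    rcases ht with rfl | rfl | rfl | rfl <;> assumption
  obtain ⟨p₅, hp₅, hp₅₃, hp₄₅⟩ : ∃ p₅ ∈ H, p₅ ≠ p₃ ∧ G.Adj p₄ p₅ := by
    obtain ⟨b, hb, z, hz, hzB, hadj⟩ := hHc.2.1.edge s4 (by simp) (ne_card (by
      have := Finset.card_le_four (a := p₁) (b := p₂) (c := p₃) (d := p₄)
      omega))
    simp only [Finset.mem_insert, Finset.mem_singleton, not_or] at hb hzB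
    rcases hb with rfl | rfl | rfl | rfl
    · rcases d₁ hadj with rfl | rfl
      · exact absurd hz haH
      · exact absurd rfl hzB.2.1
    · rcases d₂ hadj with rfl | rfl
      · exact absurd rfl hzB.1
      · exact absurd rfl hzB.2.2.1
    · rcases d₃ hadj with rfl | rfl
      · exact absurd rfl hzB.2.1
      · exact absurd rfl hzB.2.2.2
    · exact ⟨z, hz, hzB.2.2.1, hadj⟩
  have d₄ : ∀ {z}, G.Adj p₄ z → z = p₃ ∨ z = p₅ := fun hz =>
    h.deg p₄ hp₃₄.symm hp₄₅ hp₅₃.symm hz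
  have hp₄₁ : p₄ ≠ p₁ := by
    rintro rfl
    rcases d₁ hp₃₄.symm with h' | h'
    · exact nea hp₃ h'
    · exact hp₂₃.ne h'.symm
  have hp₅₁ : p₅ ≠ p₁ := by
    rintro rfl
    rcases d₁ hp₄₅.symm with h' | h'
    · exact nea hp₄ h'
    · exact hp₄₂ h'
  have hp₅₂ : p₅ ≠ p₂ := by
    rintro rfl
    rcases d₂ hp₄₅.symm with h' | h'
    · exact hp₄₁ h'
    · exact hp₃₄.ne h'.symm
  have c5 : ({p₁, p₂, p₃, p₄, p₅} : Finset V).card = 5 := by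
    rw [Finset.card_insert_of_notMem, Finset.card_insert_of_notMem, Finset.card_eq_three.2]
    · exact ⟨p₃, p₄, p₅, hp₃₄.ne, hp₅₃.symm, hp₄₅.ne, rfl⟩
    · simp [hp₂₃.ne, hp₄₂.symm, hp₅₂.symm]
    · simp [hp₁₂.ne, hp₃₁.symm, hp₄₁.symm, hp₅₁.symm]
  have s5 : ({p₁, p₂, p₃, p₄, p₅} : Finset V) ⊆ H := by
    intro t ht
    simp at ht
    rcases ht with rfl | rfl | rfl | rfl | rfl <;> assumption
  set R : Finset V := H \ {p₁, p₂, p₃, p₄, p₅} with hR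
  have hRc := Finset.card_sdiff_add_card_eq_card s5
  rw [← hR, c5] at hRc
  have hmR : ∀ z, z ∈ R ↔ z ∈ H ∧ z ≠ p₁ ∧ z ≠ p₂ ∧ z ≠ p₃ ∧ z ≠ p₄ ∧ z ≠ p₅ := by
    intro z
    simp [hR]
  have hRu : R ≠ Finset.univ := fun h' => by
    have := Finset.mem_univ v
    rw [← h', hmR] at this
    exact hvH this.1
  have hbR : ∀ C ∈ bads G R, ∃ b ∈ C, G.Adj p₅ b := by
    intro C hC
    obtain ⟨hCc, -⟩ := mem_bads.1 hC
    obtain ⟨b, hb, z, hz, hzC, hadj⟩ := hHc.2.1.edge (B := C)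
      (hCc.1.trans Finset.sdiff_subset) hCc.2.1.1 (ne_card (by
        have := Finset.card_le_card hCc.1
        omega))
    have hbR := (hmR b).1 (hCc.1 hb)
    have hzR : z ∉ R := fun hzR => hCc.2.2 b hb z (Finset.mem_sdiff.2 ⟨hzR, hzC⟩) hadj
    have hz5 : z = p₁ ∨ z = p₂ ∨ z = p₃ ∨ z = p₄ ∨ z = p₅ := by
      by_contra hcon
      push Not at hcon
      exact hzR ((hmR z).2 ⟨hz, hcon⟩)
    refine ⟨b, hb, ?_⟩
    rcases hz5 with rfl | rfl | rfl | rfl | rfl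
    · rcases d₁ hadj.symm with h' | h'
      · exact absurd h' (nea hbR.1)
      · exact absurd h' hbR.2.2.1
    · rcases d₂ hadj.symm with h' | h'
      · exact absurd h' hbR.2.1
      · exact absurd h' hbR.2.2.2.1
    · rcases d₃ hadj.symm with h' | h'
      · exact absurd h' hbR.2.2.1
      · exact absurd h' hbR.2.2.2.2.1
    · rcases d₄ hadj.symm with h' | h'
      · exact absurd h' hbR.2.2.2.1
      · exact absurd h' hbR.2.2.2.2.2
    · exact hadj.symm
  have hb1 : (bads G R).card ≤ 1 := by
    refine Finset.card_le_one.2 fun C hC C' hC' => ?_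
    obtain ⟨b, hb, hadj⟩ := hbR C hC
    obtain ⟨b', hb', hadj'⟩ := hbR C' hC'
    have hCc := (mem_bads.1 hC).1
    have hCc' := (mem_bads.1 hC').1
    have hb4 := ((hmR b).1 (hCc.1 hb)).2.2.2.2.1
    have hb4' := ((hmR b').1 (hCc'.1 hb')).2.2.2.2.1
    rcases h.deg p₅ hp₄₅.symm hadj hb4.symm hadj' with h' | h'
    · exact absurd h' hb4'
    · exact hCc.eq hCc' hb (h' ▸ hb')
  have e1 := h.sum ∅ R hRu
  simp at e1
  have e2 := io_pick (G := G) H p₄ {p₃, p₄, p₅} (by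
    intro y hy
    simp only [Finset.mem_insert, Finset.mem_singleton] at hy
    rcases hy with rfl | rfl | rfl
    · exact Or.inr hp₃₄.symm
    · exact Or.inl rfl
    · exact Or.inr hp₄₅)
  have e3 : H \ {p₃, p₄, p₅} ⊆ {p₁, p₂} ∪ R := by
    intro z hz
    simp only [Finset.mem_sdiff, Finset.mem_insert, Finset.mem_singleton, not_or] at hz
    simp only [Finset.mem_union, Finset.mem_insert, Finset.mem_singleton, hmR]
    tauto
  have e4 : Sep G {p₁, p₂} R := by
    intro b hb z hz hadj
    have hz' := (hmR z).1 hz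
    simp only [Finset.mem_insert, Finset.mem_singleton] at hb
    rcases hb with rfl | rfl
    · rcases d₁ hadj with h' | h'
      · exact nea hz'.1 h'
      · exact hz'.2.2.1 h'
    · rcases d₂ hadj with h' | h'
      · exact hz'.2.1 h'
      · exact hz'.2.2.2.1 h'
  have e5 : io G ({p₁, p₂} : Finset V) ≤ (∅ : Finset V).card := by
    refine io_le ?_
    intro x hx y hy z hz _ _ _ hxy hyz
    simp only [Finset.mem_insert, Finset.mem_singleton] at hx hy hz
    have := hxy.ne
    have := hyz.ne
    rcases hx with rfl | rfl <;> rcases hy with rfl | rfl <;> rcases hz with rfl | rfl <;> tauto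
  have e6 := io_mono (G := G) e3
  have e7 := io_union e4
  simp at e5
  omega

end Upper
section Upper2

lemma Ctr.c6 {V : Type} [Fintype V] [DecidableEq V] {G : SimpleGraph V} (h : Ctr G) :
    HasInducedC6 G := by
  obtain ⟨p0, p1, p2, p3, p4, p5, hn, a0, a1, a2, a3, a4, a5⟩ := h.six
  simp only [List.nodup_cons, List.mem_cons, List.not_mem_nil, or_false, not_or,
    List.nodup_nil, not_false_eq_true, and_true] at hn
  obtain ⟨⟨n01, n02, n03, n04, n05⟩, ⟨n12, n13, n14, n15⟩, ⟨n23, n24, n25⟩, ⟨n34, n35⟩, n45⟩ := hn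
  have d0 : ∀ c, G.Adj p0 c ↔ c = p1 ∨ c = p5 := fun c =>
    ⟨fun hc => h.deg p0 a0 a5.symm n15 hc, by rintro (rfl | rfl); exacts [a0, a5.symm]⟩
  have d1 : ∀ c, G.Adj p1 c ↔ c = p0 ∨ c = p2 := fun c =>
    ⟨fun hc => h.deg p1 a0.symm a1 n02 hc, by rintro (rfl | rfl); exacts [a0.symm, a1]⟩
  have d2 : ∀ c, G.Adj p2 c ↔ c = p1 ∨ c = p3 := fun c =>
    ⟨fun hc => h.deg p2 a1.symm a2 n13 hc, by rintro (rfl | rfl); exacts [a1.symm, a2]⟩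
  have d3 : ∀ c, G.Adj p3 c ↔ c = p2 ∨ c = p4 := fun c =>
    ⟨fun hc => h.deg p3 a2.symm a3 n24 hc, by rintro (rfl | rfl); exacts [a2.symm, a3]⟩
  have d4 : ∀ c, G.Adj p4 c ↔ c = p3 ∨ c = p5 := fun c =>
    ⟨fun hc => h.deg p4 a3.symm a4 n35 hc, by rintro (rfl | rfl); exacts [a3.symm, a4]⟩
  have d5 : ∀ c, G.Adj p5 c ↔ c = p4 ∨ c = p0 := fun c =>
    ⟨fun hc => h.deg p5 a4.symm a5 (Ne.symm n04) hc, by rintro (rfl | rfl); exacts [a4.symm, a5]⟩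
  have hinj : Function.Injective ![p0, p1, p2, p3, p4, p5] := by
    intro i j hij
    fin_cases i <;> fin_cases j <;> first | rfl | (exfalso; simp at hij; first | exact absurd hij ‹_› | exact absurd hij.symm ‹_›)
  refine ⟨⟨_, hinj⟩, ?_⟩
  have e : ∀ a b : Fin 6, (SimpleGraph.cycleGraph 6).Adj a b ↔ b = a + 1 ∨ b = a - 1 := by
    simp only [SimpleGraph.cycleGraph_adj]
    decide
  intro a b
  have hi : ∀ b c : Fin 6, ![p0, p1, p2, p3, p4, p5] b = ![p0, p1, p2, p3, p4, p5] c ↔ b = c :=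
    fun b c => hinj.eq_iff
  rw [e]
  show G.Adj (![p0, p1, p2, p3, p4, p5] a) (![p0, p1, p2, p3, p4, p5] b) ↔ _
  rw [← hi, ← hi]
  fin_cases a
  · exact d0 _
  · exact (d1 _).trans or_comm
  · exact (d2 _).trans or_comm
  · exact (d3 _).trans or_comm
  · exact (d4 _).trans or_comm
  · exact (d5 _).trans or_comm

lemma upper_aux (n : ℕ) : ∀ (V : Type) [Fintype V] [DecidableEq V] (G : SimpleGraph V),
    Fintype.card V = n → Conn G Finset.univ → ¬ HasInducedC6 G → 4 * io G Finset.univ ≤ n + 1 := by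
  induction n using Nat.strong_induction_on with
  | _ n ih =>
    intro V _ _ G hn hG h6
    by_contra hcon
    refine h6 (Ctr.c6 ⟨hG, by omega, ?_⟩)
    intro C hC hne
    have hlt : C.card < n := by
      rw [← hn]
      exact (Finset.card_lt_iff_ne_univ C).2 hne
    let H : SimpleGraph C := G.comap Subtype.val
    have hcard : Fintype.card C = C.card := Fintype.card_coe C
    have hcon : Conn H Finset.univ := by
      obtain ⟨⟨x, hx⟩, hC2⟩ := hC
      refine ⟨⟨⟨x, hx⟩, Finset.mem_univ _⟩, ?_⟩
      intro B _ hB hs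
      have hsub : B.map (Function.Embedding.subtype _) ⊆ C := by
        intro z hz
        obtain ⟨y, -, rfl⟩ := Finset.mem_map.1 hz
        exact y.2
      have := hC2 _ hsub (hB.map) (by
        intro b hb c hc
        obtain ⟨y, hy, rfl⟩ := Finset.mem_map.1 hb
        rw [Finset.mem_sdiff] at hc
        refine hs y hy ⟨c, hc.1⟩ ?_
        rw [Finset.mem_sdiff]
        exact ⟨Finset.mem_univ _, fun h => hc.2 (Finset.mem_map.2 ⟨_, h, rfl⟩)⟩)
      ext y
      simp only [Finset.mem_univ, iff_true]
      have hy : y.1 ∈ B.map (Function.Embedding.subtype _) := by rw [this]; exact y.2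
      obtain ⟨w, hw, hwy⟩ := Finset.mem_map.1 hy
      have : w = y := Subtype.ext hwy
      exact this ▸ hw
    have h6' : ¬ HasInducedC6 H := by
      rintro ⟨f, hf⟩
      exact h6 ⟨f.trans (Function.Embedding.subtype _), fun a b => hf a b⟩
    have := ih C.card hlt C H hcard hcon h6'
    obtain ⟨D, hD, hDc⟩ := io_spec (G := H) Finset.univ
    have hle : io G C ≤ io H Finset.univ := by
      rw [← hDc, ← Finset.card_map (Function.Embedding.subtype _)]
      refine io_le ?_
      have hdom : ∀ v, Dom H D v → Dom G (D.map (Function.Embedding.subtype _)) v.1 := by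
        rintro v (hv | ⟨d, hd, hv⟩)
        · exact Or.inl (Finset.mem_map.2 ⟨v, hv, rfl⟩)
        · exact Or.inr ⟨d.val, Finset.mem_map.2 ⟨d, hd, rfl⟩, hv⟩
      intro a ha b hb c hc na nb nc hab hbc
      have := hD ⟨a, ha⟩ (Finset.mem_univ _) ⟨b, hb⟩ (Finset.mem_univ _) ⟨c, hc⟩ (Finset.mem_univ _)
        (fun h => na (hdom _ h)) (fun h => nb (hdom _ h)) (fun h => nc (hdom _ h)) hab hbc
      exact congrArg Subtype.val this
    omega

lemma conn_univ {V : Type} [Fintype V] [DecidableEq V] {G : SimpleGraph V} (h : G.Connected) :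
    Conn G Finset.univ := by
  haveI := h.nonempty
  refine ⟨Finset.univ_nonempty, ?_⟩
  rintro B - ⟨x, hx⟩ hs
  have key : ∀ u v, G.Walk u v → u ∈ B → v ∈ B := by
    intro u v w
    induction w with
    | nil => exact id
    | cons hadj _ ih =>
      intro hu
      refine ih ?_
      by_contra hcon
      exact hs _ hu _ (Finset.mem_sdiff.2 ⟨Finset.mem_univ _, hcon⟩) hadj
  ext y
  simp only [Finset.mem_univ, iff_true]
  obtain ⟨w⟩ := h.preconnected x y
  exact key _ _ w hx

lemma isol_iff {V : Type} [Fintype V] [DecidableEq V] {G : SimpleGraph V} (D : Finset V) :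
    IsP3IsolatingSet G (D : Set V) ↔ Isol G Finset.univ D := by
  have hmem : ∀ v, v ∈ (closedNbhd G (D : Set V))ᶜ ↔ ¬ Dom G D v := fun v => Iff.rfl
  constructor
  · intro h a _ b _ c _ na nb nc hab hbc
    by_contra hac
    refine h ⟨⟨![⟨a, na⟩, ⟨b, nb⟩, ⟨c, nc⟩], ?_⟩, ?_⟩
    · intro i j hij
      have := hab.ne
      have := hbc.ne
      have hij2 := congrArg Subtype.val hij
      clear hij
      have n1 := hab.ne
      have n2 := hbc.ne
      fin_cases i <;> fin_cases j <;> first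
        | rfl
        | exact absurd hij2 hac
        | exact absurd hij2 n1
        | exact absurd hij2 n2
        | exact absurd hij2.symm hac
        | exact absurd hij2.symm n1
        | exact absurd hij2.symm n2
    · intro i j hij
      rw [SimpleGraph.pathGraph_adj] at hij
      fin_cases i <;> fin_cases j <;> first
        | exact hab
        | exact hbc
        | exact hab.symm
        | exact hbc.symm
        | (exfalso; simp at hij)
  · rintro h ⟨f, hf⟩
    have h1 := hf 0 1 (by rw [SimpleGraph.pathGraph_adj]; decide)
    have h2 := hf 1 2 (by rw [SimpleGraph.pathGraph_adj]; decide)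
    have := h _ (Finset.mem_univ _) _ (Finset.mem_univ _) _ (Finset.mem_univ _)
      (f 0).2 (f 1).2 (f 2).2 h1 h2
    have := f.injective (Subtype.ext this)
    exact absurd this (by decide)

lemma iota_eq {V : Type} [Fintype V] [DecidableEq V] (G : SimpleGraph V) :
    iotaP3 G = io G Finset.univ := by
  unfold iotaP3 io
  congr 1
  ext k
  constructor
  · rintro ⟨D, hD, hk⟩
    have hfin := D.toFinite
    refine ⟨hfin.toFinset, (isol_iff _).1 (by simpa using hD), ?_⟩
    rw [← hk, Set.ncard_eq_toFinset_card _ hfin]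
  · rintro ⟨D, hD, hk⟩
    exact ⟨D, (isol_iff D).2 hD, by simpa using hk⟩

end Upper2

section Lower

/-- Edges of the extremal graph, from the smaller to the larger end. -/
def Up (i j : ℕ) : Prop :=
  i < j ∧ ((i % 4 = 0 ∧ j ≤ i + 3) ∨ (i % 4 = 1 ∧ j ≤ i + 2) ∨ (2 ≤ i % 4 ∧ j = i + 2))

/-- The (infinite) extremal graph. -/
def Lad : SimpleGraph ℕ where
  Adj i j := Up i j ∨ Up j i
  symm := ⟨fun _ _ h => h.symm⟩
  loopless := ⟨fun i h => by simp [Up] at h⟩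

lemma lad_adj {i j : ℕ} : Lad.Adj i j ↔
    (i < j ∧ ((i % 4 = 0 ∧ j ≤ i + 3) ∨ (i % 4 = 1 ∧ j ≤ i + 2) ∨ (2 ≤ i % 4 ∧ j = i + 2))) ∨
    (j < i ∧ ((j % 4 = 0 ∧ i ≤ j + 3) ∨ (j % 4 = 1 ∧ i ≤ j + 2) ∨ (2 ≤ j % 4 ∧ i = j + 2))) :=
  Iff.rfl

lemma Isol.transfer {V : Type} {G : SimpleGraph V} {A B D E : Finset V} (h : Isol G A D)
    (hBA : B ⊆ A) (hd : ∀ z ∈ B, Dom G D z → Dom G E z) : Isol G B E :=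
  fun a ha b hb c hc na nb nc => h a (hBA ha) b (hBA hb) c (hBA hc)
    (fun h' => na (hd a ha h')) (fun h' => nb (hd b hb h')) (fun h' => nc (hd c hc h'))

structure Rec (m : ℕ) : Prop where
  one : ∀ D ⊆ Finset.range (4 * m + 4), Isol Lad (Finset.range (4 * m + 3)) D → m + 1 ≤ D.card
  one' : ∀ D ⊆ Finset.range (4 * m + 4),
    Isol Lad ((Finset.range (4 * m + 4)).erase (4 * m + 2)) D → m + 1 ≤ D.card
  two : ∀ D ⊆ Finset.range (4 * m + 4), (4 * m + 2 ∈ D ∨ 4 * m + 3 ∈ D) →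
    (4 * m ∈ D ∨ 4 * m + 1 ∈ D) → Isol Lad (Finset.range (4 * m + 4)) D → m + 2 ≤ D.card

lemma rec_zero : Rec 0 := by
  refine ⟨?_, ?_, ?_⟩
  · intro D _ h
    by_contra hcon
    have : D = ∅ := by
      rw [← Finset.card_eq_zero]
      omega
    subst this
    have := h 0 (by simp) 1 (by simp) 2 (by simp) (by simp [Dom]) (by simp [Dom]) (by simp [Dom])
      (lad_adj.2 (by omega)) (lad_adj.2 (by omega))
    omega
  · intro D _ h
    by_contra hcon
    have : D = ∅ := by
      rw [← Finset.card_eq_zero]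
      omega
    subst this
    have := h 0 (by simp) 1 (by simp) 3 (by simp) (by simp [Dom]) (by simp [Dom]) (by simp [Dom])
      (lad_adj.2 (by omega)) (lad_adj.2 (by omega))
    omega
  · intro D _ h1 h2 _
    have : 1 < D.card := by
      rw [Finset.one_lt_card]
      rcases h1 with h1 | h1 <;> rcases h2 with h2 | h2 <;>
        exact ⟨_, h1, _, h2, by omega⟩
    omega

/-- The part of `D` below `4 m + 4`. -/
def low (m : ℕ) (D : Finset ℕ) : Finset ℕ := D.filter (fun z => z < 4 * m + 4)

/-- The part of `D` from `4 m + 4` on. -/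
def high (m : ℕ) (D : Finset ℕ) : Finset ℕ := D.filter (fun z => ¬ z < 4 * m + 4)

lemma low_high (m : ℕ) (D : Finset ℕ) : (low m D).card + (high m D).card = D.card :=
  Finset.card_filter_add_card_filter_not _

lemma low_sub (m : ℕ) (D : Finset ℕ) : low m D ⊆ Finset.range (4 * m + 4) := by
  intro z hz
  simp only [low, Finset.mem_filter] at hz
  simp [hz.2]

lemma dom_low {m : ℕ} {D : Finset ℕ} {z : ℕ} (hz : z < 4 * m + 4) (h : Dom Lad D z) :
    Dom Lad (low m D) z ∨ (4 * m + 4 ∈ D ∧ z = 4 * m + 2) ∨ (4 * m + 5 ∈ D ∧ z = 4 * m + 3) := by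
  rcases h with h | ⟨d, hd, h⟩
  · exact Or.inl (Or.inl (Finset.mem_filter.2 ⟨h, hz⟩))
  · by_cases hdm : d < 4 * m + 4
    · exact Or.inl (Or.inr ⟨d, Finset.mem_filter.2 ⟨hd, hdm⟩, h⟩)
    · right
      rw [lad_adj] at h
      have : (d = 4 * m + 4 ∧ z = 4 * m + 2) ∨ (d = 4 * m + 5 ∧ z = 4 * m + 3) := by omega
      rcases this with ⟨rfl, rfl⟩ | ⟨rfl, rfl⟩
      · exact Or.inl ⟨hd, rfl⟩
      · exact Or.inr ⟨hd, rfl⟩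

lemma dom_mono_nat {D E : Finset ℕ} (h : D ⊆ E) {v : ℕ} (hv : Dom Lad D v) : Dom Lad E v := by
  rcases hv with hv | ⟨d, hd, hv⟩
  · exact Or.inl (h hv)
  · exact Or.inr ⟨d, h hd, hv⟩

lemma Rec.pre {m : ℕ} (h : Rec m) {D : Finset ℕ}
    (hD : Isol Lad (Finset.range (4 * m + 4)) D) :
    m ≤ (low m D).card ∧ ((4 * m + 4 ∉ D ∨ 4 * m + 5 ∉ D) → m + 1 ≤ (low m D).card) := by
  constructor
  · have h1 := h.one (insert (4 * m + 2) (low m D)) (by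
      intro z hz
      rcases Finset.mem_insert.1 hz with rfl | hz
      · simp
      · exact low_sub m D hz) (hD.transfer (by intro z; simp; omega) (by
      intro z hz hd
      rw [Finset.mem_range] at hz
      rcases dom_low (m := m) (by omega) hd with h' | ⟨-, rfl⟩ | ⟨-, rfl⟩
      · exact dom_mono_nat (Finset.subset_insert _ _) h'
      · exact Or.inl (Finset.mem_insert_self _ _)
      · omega))
    have := Finset.card_insert_le (4 * m + 2) (low m D)
    omega
  · rintro (h4 | h5)
    · refine h.one _ (low_sub m D) (hD.transfer (by intro z; simp; omega) ?_)
      intro z hz hd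
      rw [Finset.mem_range] at hz
      rcases dom_low (m := m) (by omega) hd with h' | ⟨h', rfl⟩ | ⟨-, rfl⟩
      · exact h'
      · exact absurd h' h4
      · omega
    · refine h.one' _ (low_sub m D) (hD.transfer (Finset.erase_subset _ _) ?_)
      intro z hz hd
      rw [Finset.mem_erase, Finset.mem_range] at hz
      rcases dom_low (m := m) (by omega) hd with h' | ⟨h', rfl⟩ | ⟨h', rfl⟩
      · exact h'
      · omega
      · exact absurd h' h5

lemma mem_high {m z : ℕ} {D : Finset ℕ} (h : z ∈ D) (hz : 4 * m + 4 ≤ z) : z ∈ high m D :=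
  Finset.mem_filter.2 ⟨h, by omega⟩

lemma ndom {D : Finset ℕ} {z : ℕ} (h0 : z ∉ D) (h : ∀ d ∈ D, ¬ Lad.Adj d z) : ¬ Dom Lad D z := by
  rintro (h1 | ⟨d, hd, h1⟩)
  · exact h0 h1
  · exact h d hd h1

lemma Rec.step {m : ℕ} (h : Rec m) {D A : Finset ℕ} {t : ℕ} (ht : t = 4 * m + 6 ∨ t = 4 * m + 7)
    (hA : ∀ z, z < 4 * m + 6 ∨ z = t → z ∈ A) (hD : Isol Lad A D) : m + 2 ≤ D.card := by
  have hD4 : Isol Lad (Finset.range (4 * m + 4)) D := hD.transfer (fun z hz => hA z (by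
    rw [Finset.mem_range] at hz; omega)) (fun z _ h => h)
  have hc := low_high m D
  obtain ⟨p1, p2⟩ := h.pre hD4
  by_cases hE : high m D = ∅
  · have hlt : ∀ d ∈ D, d < 4 * m + 4 := by
      intro d hd
      by_contra hcon
      have := mem_high (m := m) hd (by omega)
      simp [hE] at this
    have hsub : D ⊆ Finset.range (4 * m + 4) := fun d hd => Finset.mem_range.2 (hlt d hd)
    have nt : ¬ Dom Lad D t := ndom (fun h' => by have := hlt _ h'; omega) (fun d hd => by
      have := hlt _ hd
      rw [lad_adj]; omega)
    have na : 4 * m + 2 ∉ D → ¬ Dom Lad D (4 * m + 4) := fun h2 =>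
      ndom (fun h' => by have := hlt _ h'; omega) (fun d hd => by
        have := hlt _ hd
        have : d ≠ 4 * m + 2 := fun e => h2 (e ▸ hd)
        rw [lad_adj]; omega)
    have nb : 4 * m + 3 ∉ D → ¬ Dom Lad D (4 * m + 5) := fun h2 =>
      ndom (fun h' => by have := hlt _ h'; omega) (fun d hd => by
        have := hlt _ hd
        have : d ≠ 4 * m + 3 := fun e => h2 (e ▸ hd)
        rw [lad_adj]; omega)
    by_cases h2 : 4 * m + 2 ∈ D
    · by_cases h3 : 4 * m + 3 ∈ D
      · have := h.one (D.erase (4 * m + 3)) ((Finset.erase_subset _ _).trans hsub)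
          (hD.transfer (fun z hz => hA z (by rw [Finset.mem_range] at hz; omega)) (by
            intro z hz hd
            rw [Finset.mem_range] at hz
            rcases hd with hd | ⟨d, hd, had⟩
            · exact Or.inl (Finset.mem_erase.2 ⟨by omega, hd⟩)
            · by_cases hd3 : d = 4 * m + 3
              · refine Or.inr ⟨4 * m + 2, Finset.mem_erase.2 ⟨by omega, h2⟩, ?_⟩
                subst hd3
                rw [lad_adj] at had ⊢
                omega
              · exact Or.inr ⟨d, Finset.mem_erase.2 ⟨hd3, hd⟩, had⟩))
        rw [Finset.card_erase_of_mem h3] at this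
        omega
      · have hdm : Dom Lad D (4 * m + 3) := by
          by_contra hcon
          have := hD _ (hA (4 * m + 3) (by omega)) _ (hA (4 * m + 5) (by omega)) _ (hA t (by omega))
            hcon (nb h3) nt (lad_adj.2 (by omega)) (lad_adj.2 (by omega))
          omega
        rcases hdm with h' | ⟨d, hd, had⟩
        · exact absurd h' h3
        · have := hlt _ hd
          rw [lad_adj] at had
          have : d = 4 * m ∨ d = 4 * m + 1 := by omega
          exact h.two D hsub (Or.inl h2) (by rcases this with rfl | rfl <;> simp [hd]) hD4
    · by_cases h3 : 4 * m + 3 ∈ D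
      · have hdm : Dom Lad D (4 * m + 2) := by
          by_contra hcon
          have := hD _ (hA (4 * m + 2) (by omega)) _ (hA (4 * m + 4) (by omega)) _ (hA t (by omega))
            hcon (na h2) nt (lad_adj.2 (by omega)) (lad_adj.2 (by omega))
          omega
        rcases hdm with h' | ⟨d, hd, had⟩
        · exact absurd h' h2
        · have := hlt _ hd
          rw [lad_adj] at had
          have : d = 4 * m ∨ d = 4 * m + 1 := by omega
          exact h.two D hsub (Or.inr h3) (by rcases this with rfl | rfl <;> simp [hd]) hD4
      · exfalso
        have := hD _ (hA (4 * m + 4) (by omega)) _ (hA (4 * m + 5) (by omega)) _ (hA t (by omega))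
            (na h2) (nb h3) nt (lad_adj.2 (by omega)) (lad_adj.2 (by omega))
        omega
  · have hpos : 0 < (high m D).card := Finset.card_pos.2 (Finset.nonempty_iff_ne_empty.2 hE)
    by_cases hab : 4 * m + 4 ∈ D ∧ 4 * m + 5 ∈ D
    · have : 1 < (high m D).card := Finset.one_lt_card.2
        ⟨_, mem_high hab.1 (by omega), _, mem_high hab.2 (by omega), by omega⟩
      omega
    · have := p2 (by tauto)
      omega

lemma rec_succ {m : ℕ} (h : Rec m) : Rec (m + 1) := by
  refine ⟨?_, ?_, ?_⟩
  · intro D _ hD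
    exact h.step (Or.inl rfl) (by intro z hz; rw [Finset.mem_range]; omega) hD
  · intro D _ hD
    exact h.step (Or.inr rfl) (by intro z hz; rw [Finset.mem_erase, Finset.mem_range]; omega) hD
  · intro D _ hc ha hD
    have hc1 := low_high m D
    obtain ⟨p1, p2⟩ := h.pre (D := D) (hD.transfer (by intro z; simp; omega) (fun z _ h => h))
    have e1 : 4 * (m + 1) + 2 = 4 * m + 6 := by ring
    have e2 : 4 * (m + 1) + 3 = 4 * m + 7 := by ring
    have e3 : 4 * (m + 1) = 4 * m + 4 := by ring
    have e4 : 4 * (m + 1) + 1 = 4 * m + 5 := by ring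
    rw [e1, e2] at hc
    rw [e4, e3] at ha
    by_cases hab : 4 * m + 4 ∈ D ∧ 4 * m + 5 ∈ D
    · have : 2 < (high m D).card := by
        rw [Finset.two_lt_card]
        rcases hc with hc | hc <;>
        exact ⟨_, mem_high hab.1 (by omega), _, mem_high hab.2 (by omega), _,
          mem_high hc (by omega), by omega, by omega, by omega⟩
      omega
    · have := p2 (by tauto)
      have : 1 < (high m D).card := by
        rw [Finset.one_lt_card]
        rcases hc with hc | hc <;> rcases ha with ha | ha <;>
        exact ⟨_, mem_high ha (by omega), _, mem_high hc (by omega), by omega⟩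
      omega

lemma rec_all (m : ℕ) : Rec m := by
  induction m with
  | zero => exact rec_zero
  | succ m ih => exact rec_succ ih

lemma lad_lower {n : ℕ} {D : Finset ℕ} (hs : D ⊆ Finset.range n)
    (hD : Isol Lad (Finset.range n) D) : (n + 1) / 4 ≤ D.card := by
  by_cases hn : n < 3
  · have : (n + 1) / 4 = 0 := by omega
    omega
  obtain ⟨k, hk, hk'⟩ : ∃ k, (n + 1) / 4 = k + 1 ∧ 4 * k + 3 ≤ n := ⟨(n + 1) / 4 - 1, by omega, by omega⟩
  have h := rec_all k
  rw [hk]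
  by_cases hE : high k D = ∅
  · refine h.one D ?_ (hD.transfer (by intro z; simp; omega) (fun z _ h => h))
    intro d hd
    by_contra hcon
    have := mem_high (m := k) hd (by simpa using hcon)
    simp [hE] at this
  · obtain ⟨z, hz⟩ := Finset.nonempty_iff_ne_empty.2 hE
    have hz' := Finset.mem_filter.1 hz
    have := Finset.mem_range.1 (hs hz'.1)
    have := low_high k D
    have := (h.pre (D := D) (hD.transfer (by intro z; simp; omega) (fun z _ h => h))).1
    have hpos : 0 < (high k D).card := Finset.card_pos.2 ⟨z, hz⟩
    omega
end Lower
section Lower2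

lemma cyc_rot : ∀ i a b : Fin 6,
    (SimpleGraph.cycleGraph 6).Adj (i + a) (i + b) ↔ (SimpleGraph.cycleGraph 6).Adj a b := by
  simp only [SimpleGraph.cycleGraph_adj]
  decide

lemma cyc_no {p q r s t : ℕ} (hq : q < p) (hr : r < p) (hs : s < p) (ht : t < p)
    (hqr : q ≠ r) (hst : s ≠ t) (hqt : q ≠ t) (hrs : r ≠ s)
    (a1 : Lad.Adj p q) (a2 : Lad.Adj p r) (a3 : Lad.Adj q s) (a4 : Lad.Adj r t)
    (n0 : ¬ Lad.Adj q r) (n1 : ¬ Lad.Adj s t) (n2 : ¬ Lad.Adj p s) (n3 : ¬ Lad.Adj p t)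
    (n4 : ¬ Lad.Adj q t) (n5 : ¬ Lad.Adj r s) : False := by
  simp only [lad_adj] at *
  have h1 : p % 4 = 1 ∧ ((q = p - 1 ∧ r = p - 2) ∨ (q = p - 2 ∧ r = p - 1)) := by
    clear a3 a4 n1 n2 n3 n4 n5
    omega
  rcases h1 with ⟨hp, ⟨rfl, rfl⟩ | ⟨rfl, rfl⟩⟩
  · have : s = p - 3 := by clear a1 a2 a4 n0 n1 n3 n4 n5; omega
    have : t = p - 5 ∨ t = p - 4 := by clear a1 a2 a3 n0 n1 n2 n4 n5; omega
    clear a1 a2 a3 a4 n0 n2 n3 n4 n5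
    omega
  · have : t = p - 3 := by clear a1 a2 a3 n0 n1 n2 n4 n5; omega
    have : s = p - 5 ∨ s = p - 4 := by clear a1 a2 a4 n0 n1 n3 n4 n5; omega
    clear a1 a2 a3 a4 n0 n2 n3 n4 n5
    omega

/-- The extremal graph on `n` vertices. -/
def LadF (n : ℕ) : SimpleGraph (Fin n) := Lad.comap Fin.val

lemma ladF_noC6 (n : ℕ) : ¬ HasInducedC6 (LadF n) := by
  rintro ⟨f, hf⟩
  obtain ⟨i, hi⟩ := Finite.exists_max (fun i => (f i).val)
  have key : ∀ a b, Lad.Adj (f (i + a)).val (f (i + b)).val ↔ (SimpleGraph.cycleGraph 6).Adj a b :=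
    fun a b => (hf (i + a) (i + b)).trans (cyc_rot i a b)
  have hne : ∀ a b, a ≠ b → (f (i + a)).val ≠ (f (i + b)).val := fun a b hab h =>
    hab (by simpa using f.injective (Fin.ext h))
  have hlt : ∀ a, a ≠ 0 → (f (i + a)).val < (f (i + 0)).val := fun a ha =>
    lt_of_le_of_ne (by simpa using hi (i + a)) (hne a 0 ha)
  simp only [SimpleGraph.cycleGraph_adj] at key
  exact cyc_no (hlt 1 (by decide)) (hlt 5 (by decide)) (hlt 2 (by decide)) (hlt 4 (by decide))
    (hne 1 5 (by decide)) (hne 2 4 (by decide)) (hne 1 4 (by decide)) (hne 5 2 (by decide))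
    ((key 0 1).2 (by decide)) ((key 0 5).2 (by decide)) ((key 1 2).2 (by decide))
    ((key 5 4).2 (by decide)) (mt (key 1 5).1 (by decide)) (mt (key 2 4).1 (by decide))
    (mt (key 0 2).1 (by decide)) (mt (key 0 4).1 (by decide)) (mt (key 1 4).1 (by decide))
    (mt (key 5 2).1 (by decide))

lemma ladF_conn (n : ℕ) (hn : 1 ≤ n) : (LadF n).Connected := by
  have key : ∀ k (hk : k < n), (LadF n).Reachable ⟨0, hn⟩ ⟨k, hk⟩ := by
    intro k
    induction k using Nat.strong_induction_on with
    | _ k ih =>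
      intro hk
      by_cases h0 : k = 0
      · subst h0
        exact SimpleGraph.Reachable.refl _
      · obtain ⟨j, hj, hadj⟩ : ∃ j, j < k ∧ Lad.Adj j k := by
          simp only [lad_adj]
          by_cases h1 : k % 4 = 1
          · exact ⟨k - 1, by omega, by omega⟩
          · exact ⟨k - 2 + (if k % 4 = 2 then 1 else 0), by split_ifs <;> omega, by split_ifs <;> omega⟩
        have hadj' : (LadF n).Adj ⟨j, hj.trans hk⟩ ⟨k, hk⟩ := hadj
        exact (ih j hj (hj.trans hk)).trans hadj'.reachable
  haveI : Nonempty (Fin n) := ⟨⟨0, hn⟩⟩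
  exact SimpleGraph.Connected.mk fun a b => (key a.1 a.2).symm.trans (key b.1 b.2)

lemma ladF_lower {n : ℕ} {D : Finset (Fin n)} (hD : Isol (LadF n) Finset.univ D) :
    (n + 1) / 4 ≤ D.card := by
  rw [← Finset.card_map Fin.valEmbedding]
  have hdom : ∀ v, Dom (LadF n) D v → Dom Lad (D.map Fin.valEmbedding) v.val := by
    rintro v (hv | ⟨d, hd, hv⟩)
    · exact Or.inl (Finset.mem_map.2 ⟨v, hv, rfl⟩)
    · exact Or.inr ⟨d.val, Finset.mem_map.2 ⟨d, hd, rfl⟩, hv⟩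
  refine lad_lower ?_ ?_
  · intro z hz
    obtain ⟨d, -, rfl⟩ := Finset.mem_map.1 hz
    exact Finset.mem_range.2 d.2
  · intro a ha b hb c hc na nb nc hab hbc
    rw [Finset.mem_range] at ha hb hc
    have := hD ⟨a, ha⟩ (Finset.mem_univ _) ⟨b, hb⟩ (Finset.mem_univ _) ⟨c, hc⟩ (Finset.mem_univ _)
      (fun h => na (hdom _ h)) (fun h => nb (hdom _ h)) (fun h => nc (hdom _ h)) hab hbc
    exact congrArg Fin.val this

end Lower2
end P3

theorem stmt_15 (n : ℕ) (hn : 1 ≤ n) : fmax n = (n + 1) / 4 := by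
  have hub : ∀ G : SimpleGraph (Fin n), G.Connected → ¬ HasInducedC6 G → iotaP3 G ≤ (n + 1) / 4 := by
    intro G hG h6
    have := P3.upper_aux n (Fin n) G (Fintype.card_fin n) (P3.conn_univ hG) h6
    rw [P3.iota_eq]
    omega
  have hlow : (n + 1) / 4 ≤ iotaP3 (P3.LadF n) := by
    rw [P3.iota_eq]
    obtain ⟨D, hD, hc⟩ := P3.io_spec (G := P3.LadF n) Finset.univ
    rw [← hc]
    exact P3.ladF_lower hD
  have hmem : (n + 1) / 4 ∈
      {m | ∃ G : SimpleGraph (Fin n), G.Connected ∧ ¬ HasInducedC6 G ∧ iotaP3 G = m} :=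
    ⟨P3.LadF n, P3.ladF_conn n hn, P3.ladF_noC6 n,
      le_antisymm (hub _ (P3.ladF_conn n hn) (P3.ladF_noC6 n)) hlow⟩
  refine IsGreatest.csSup_eq ⟨hmem, ?_⟩
  rintro m ⟨G, hG, h6, rfl⟩
  exact hub G hG h6
end

section
/- For any connected n-vertex graph G with maximum degree 2 and n ≥ 4 that is not isomorphic to C_6, ι(G, P_3) ≤ (n+1)/4 holds, and equality ι(G, P_3) = (n+1)/4 forces G to be isomorphic to C_7 or C_11. -/
open SimpleGraph

lemma aux_three {V : Type*} [Fintype V] (G : SimpleGraph V)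
    (hdeg₁ : ∀ v : V, (G.neighborSet v).ncard ≤ 2) (v a b c : V)
    (ha : G.Adj v a) (hb : G.Adj v b) (hc : G.Adj v c)
    (hab : a ≠ b) (hac : a ≠ c) (hbc : b ≠ c) : False := by
  classical
  have h3 : ({a, b, c} : Set V).ncard = 3 := Set.ncard_eq_three.2 ⟨a, b, c, hab, hac, hbc, rfl⟩
  have hsub : ({a, b, c} : Set V) ⊆ G.neighborSet v := by
    rintro x (rfl | rfl | rfl) <;> simpa
  have := Set.ncard_le_ncard hsub (Set.toFinite _)
  have := hdeg₁ v
  omega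

def Chain {V : Type*} (G : SimpleGraph V) (m : ℕ) (f : ℕ → V) : Prop :=
  (∀ i j, i < m → j < m → f i = f j → i = j) ∧ ∀ i, i + 1 < m → G.Adj (f i) (f (i + 1))

lemma aux_ham {V : Type*} [Fintype V] (G : SimpleGraph V) (hc : G.Connected)
    (hdeg₁ : ∀ v : V, (G.neighborSet v).ncard ≤ 2) :
    ∃ f : ℕ → V, Chain G (Fintype.card V) f ∧ ∀ v, ∃ i < Fintype.card V, f i = v := by
  classical
  have hb : ∀ m, (∃ f, Chain G m f) → m ≤ Fintype.card V := by
    rintro m ⟨f, hf, -⟩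
    have := Fintype.card_le_of_injective (fun i : Fin m => f i)
      (fun i j h => Fin.ext (hf i j i.2 j.2 h))
    simpa using this
  obtain ⟨v0⟩ := hc.nonempty
  have h1 : ∃ f, Chain G 1 f := ⟨fun _ => v0, by intro i j; omega, by intro i; omega⟩
  set m := Nat.findGreatest (fun m => ∃ f, Chain G m f) (Fintype.card V) with hm
  have hm1 : 1 ≤ m := Nat.le_findGreatest (hb 1 h1) h1
  have hP : ∃ f, Chain G m f :=
    Nat.findGreatest_spec (P := fun m => ∃ f, Chain G m f) (hb 1 h1) h1
  have hmax : ¬ ∃ f, Chain G (m + 1) f := by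
    intro h
    have := Nat.le_findGreatest (P := fun m => ∃ f, Chain G m f) (hb _ h) h
    omega
  obtain ⟨f, hf⟩ := hP
  have hsurj : ∀ v, ∃ i < m, f i = v := by
    by_contra! hcon
    obtain ⟨v, hv⟩ := hcon
    obtain ⟨p⟩ := hc.preconnected (f 0) v
    obtain ⟨d, -, hd1, hd2⟩ := p.exists_boundary_dart {v | ∃ i < m, f i = v}
      ⟨0, hm1, rfl⟩ (by rintro ⟨i, hi, h⟩; exact hv i hi h)
    obtain ⟨i, hi, hfi⟩ := hd1
    have hadj := d.adj
    rw [← hfi] at hadj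
    set y := d.snd
    have hy : ∀ j < m, f j ≠ y := fun j hj h => hd2 ⟨j, hj, h⟩
    by_cases hlast : i + 1 = m
    · apply hmax
      refine ⟨fun j => if j = m then y else f j, ?_, ?_⟩
      · intro a b ha hb hab
        have := hf.1 a b
        have := hy a
        have := hy b
        grind
      · intro a ha
        have := hf.2 a
        grind
    by_cases h0 : i = 0
    · apply hmax
      refine ⟨fun j => if j = 0 then y else f (j - 1), ?_, ?_⟩
      · intro a b ha hb hab
        have := hf.1 (a-1) (b-1)
        have := hy (a-1)
        have := hy (b-1)
        grind
      · intro a ha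
        have := hf.2 (a-1)
        have := hadj.symm
        grind
    · have e1 := hf.2 (i-1) (by omega)
      have e2 := hf.2 i (by omega)
      rw [show i - 1 + 1 = i by omega] at e1
      refine aux_three G hdeg₁ (f i) (f (i-1)) (f (i+1)) y e1.symm e2 hadj ?_
        (hy _ (by omega)) (hy _ (by omega))
      intro h
      have := hf.1 _ _ (by omega) (by omega) h
      omega
  have hle := hb m ⟨f, hf⟩
  have hge : Fintype.card V ≤ m := by
    have := Fintype.card_le_of_surjective (fun i : Fin m => f i)
      (fun v => by obtain ⟨i, hi, h⟩ := hsurj v; exact ⟨⟨i, hi⟩, h⟩)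
    simpa using this
  have : m = Fintype.card V := le_antisymm hle hge
  rw [← this]
  exact ⟨f, hf, hsurj⟩

lemma aux_adj {V : Type*} [Fintype V] (G : SimpleGraph V)
    (hdeg₁ : ∀ v : V, (G.neighborSet v).ncard ≤ 2) (n : ℕ) (f : ℕ → V) (hf : Chain G n f)
    (i j : ℕ) (hij : i < j) (hj : j < n) (h : G.Adj (f i) (f j)) :
    j = i + 1 ∨ (i = 0 ∧ j + 1 = n) := by
  by_contra! hcon
  have hne : ∀ a b, a < n → b < n → a ≠ b → f a ≠ f b :=
    fun a b ha hb hab h => hab (hf.1 a b ha hb h)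
  by_cases h0 : i = 0
  · have e1 := hf.2 (j-1) (by omega)
    have e2 := hf.2 j (by omega)
    rw [show j - 1 + 1 = j by omega] at e1
    exact aux_three G hdeg₁ (f j) (f (j-1)) (f (j+1)) (f i) e1.symm e2 h.symm
      (hne _ _ (by omega) (by omega) (by omega)) (hne _ _ (by omega) (by omega) (by omega))
      (hne _ _ (by omega) (by omega) (by omega))
  · have e1 := hf.2 (i-1) (by omega)
    have e2 := hf.2 i (by omega)
    rw [show i - 1 + 1 = i by omega] at e1
    exact aux_three G hdeg₁ (f i) (f (i-1)) (f (i+1)) (f j) e1.symm e2 h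
      (hne _ _ (by omega) (by omega) (by omega)) (hne _ _ (by omega) (by omega) (by omega))
      (hne _ _ (by omega) (by omega) (by omega))

lemma aux_iota {V : Type*} [Fintype V] (G : SimpleGraph V) (k : ℕ) (g : ℕ → V)
    (h : ∀ a b c : V, G.Adj a b → G.Adj b c → a ≠ c →
      (∀ j < k, g j ≠ a ∧ ¬ G.Adj (g j) a) → (∀ j < k, g j ≠ b ∧ ¬ G.Adj (g j) b) →
      (∀ j < k, g j ≠ c ∧ ¬ G.Adj (g j) c) → False) : iotaP3 G ≤ k := by
  classical
  have hD : IsP3IsolatingSet G (((Finset.range k).image g : Finset V) : Set V) := by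
    rintro ⟨φ, hφ⟩
    have h01 := hφ 0 1 (by simp [pathGraph_adj])
    have h12 := hφ 1 2 (by simp [pathGraph_adj])
    simp only [comap_adj] at h01 h12
    have key : ∀ x : ((closedNbhd G (((Finset.range k).image g : Finset V) : Set V))ᶜ : Set V),
        ∀ j < k, g j ≠ x ∧ ¬ G.Adj (g j) x := by
      rintro ⟨x, hx⟩ j hj
      constructor
      · rintro h
        exact hx (Or.inl (by simpa using ⟨j, hj, h⟩))
      · intro h
        exact hx (Or.inr ⟨g j, by simpa using ⟨j, hj, rfl⟩, h⟩)
    refine h (φ 0) (φ 1) (φ 2) h01 h12 ?_ (key _) (key _) (key _)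
    intro h
    have := φ.injective (Subtype.ext h)
    simp at this
  have hle : iotaP3 G ≤ (((Finset.range k).image g : Finset V) : Set V).ncard :=
    Nat.sInf_le ⟨_, hD, rfl⟩
  refine hle.trans ?_
  rw [Set.ncard_coe_finset]
  exact Finset.card_image_le.trans (by simp)

lemma aux_iso {V : Type*} [Fintype V] (G : SimpleGraph V)
    (hdeg₁ : ∀ v : V, (G.neighborSet v).ncard ≤ 2) (n : ℕ) (hn : 4 ≤ n) (f : ℕ → V)
    (hf : Chain G n f) (hs : ∀ v, ∃ i < n, f i = v) (he : G.Adj (f 0) (f (n - 1))) :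
    Nonempty (G ≃g cycleGraph n) := by
  have hbij : Function.Bijective (fun i : Fin n => f i) :=
    ⟨fun i j h => Fin.ext (hf.1 i j i.2 j.2 h),
      fun v => by obtain ⟨i, hi, h⟩ := hs v; exact ⟨⟨i, hi⟩, h⟩⟩
  refine ⟨(RelIso.symm ⟨Equiv.ofBijective _ hbij, ?_⟩ : G ≃g cycleGraph n)⟩
  intro a b
  simp only [Equiv.ofBijective_apply]
  have hlt : ∀ a b : Fin n, a < b → (G.Adj (f a) (f b) ↔ (cycleGraph n).Adj a b) := by
    rintro ⟨a, ha⟩ ⟨b, hb⟩ hab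
    simp only [Fin.mk_lt_mk] at hab
    rw [cycleGraph_adj', Fin.coe_sub_iff_lt.2 (by simpa using hab),
      Fin.coe_sub_iff_le.2 (by simpa using hab.le)]
    simp only
    constructor
    · intro h
      have := aux_adj G hdeg₁ n f hf a b hab hb h
      omega
    · intro h
      have h' : b = a + 1 ∨ (a = 0 ∧ b = n - 1) := by omega
      rcases h' with rfl | ⟨rfl, rfl⟩
      · exact hf.2 a hb
      · exact he
  rcases lt_trichotomy a b with h | h | h
  · exact hlt a b h
  · subst h; simp
  · rw [G.adj_comm, (cycleGraph n).adj_comm]; exact hlt b a h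

theorem stmt_19 {V : Type*} [Fintype V] (G : SimpleGraph V)
    (hc : G.Connected) (hn : 4 ≤ Fintype.card V)
    (hdeg₁ : ∀ v : V, (G.neighborSet v).ncard ≤ 2)
    (hdeg₂ : ∃ v : V, (G.neighborSet v).ncard = 2)
    (h6 : IsEmpty (G ≃g SimpleGraph.cycleGraph 6)) :
    4 * iotaP3 G ≤ Fintype.card V + 1 ∧
    (4 * iotaP3 G = Fintype.card V + 1 →
      Nonempty (G ≃g SimpleGraph.cycleGraph 7) ∨
      Nonempty (G ≃g SimpleGraph.cycleGraph 11)) := by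
  obtain ⟨f, hf, hs⟩ := aux_ham G hc hdeg₁
  generalize Fintype.card V = n at *
  have hA := aux_adj G hdeg₁ n f hf
  by_cases he : G.Adj (f 0) (f (n - 1))
  · have hiso := aux_iso G hdeg₁ n hn f hf hs he
    have hi : iotaP3 G ≤ (n + 4) / 5 := by
      apply aux_iota G _ (fun j => f (5 * j))
      intro a b c hab hbc hac ha hb hc'
      obtain ⟨a, han, rfl⟩ := hs a
      obtain ⟨b, hbn, rfl⟩ := hs b
      obtain ⟨c, hcn, rfl⟩ := hs c
      have key : ∀ x < n, (∀ j < (n + 4) / 5, f (5 * j) ≠ f x ∧ ¬ G.Adj (f (5 * j)) (f x)) →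
          (x % 5 = 2 ∨ x % 5 = 3) ∧ x + 1 ≠ n := by
        intro x hx h
        have h0 : x % 5 ≠ 0 := by
          intro h0
          refine (h (x / 5) (by omega)).1 ?_
          congr 1; omega
        have h1 : x % 5 ≠ 1 := by
          intro h1
          refine (h (x / 5) (by omega)).2 ?_
          have := hf.2 (5 * (x / 5)) (by omega)
          rwa [show 5 * (x / 5) + 1 = x by omega] at this
        have hl : x + 1 ≠ n := by
          intro hl
          refine (h 0 (by omega)).2 ?_
          rwa [show n - 1 = x by omega] at he
        have h4 : x % 5 ≠ 4 := by
          intro h4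
          refine (h (x / 5 + 1) (by omega)).2 ?_
          have := (hf.2 x (by omega)).symm
          rwa [show x + 1 = 5 * (x / 5 + 1) by omega] at this
        omega
      have ka := key a han ha
      have kb := key b hbn hb
      have kc := key c hcn hc'
      have hac' : a ≠ c := fun h => hac (by rw [h])
      have hab' : a ≠ b := fun h => hab.ne (by rw [h])
      have hbc' : b ≠ c := fun h => hbc.ne (by rw [h])
      have a1 := fun h => hA a b h hbn hab
      have a2 := fun h => hA b a h han hab.symm
      have a3 := fun h => hA b c h hcn hbc
      have a4 := fun h => hA c b h hbn hbc.symm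
      omega
    have hn6 : n ≠ 6 := by
      rintro rfl
      exact not_isEmpty_iff.2 hiso h6
    refine ⟨by omega, fun h => ?_⟩
    have : n = 7 ∨ n = 11 := by omega
    rcases this with rfl | rfl
    · exact Or.inl hiso
    · exact Or.inr hiso
  · have hA' : ∀ i j, i < j → j < n → G.Adj (f i) (f j) → j = i + 1 := by
      intro i j hij hj h
      rcases hA i j hij hj h with h1 | ⟨rfl, h1⟩
      · exact h1
      · exact absurd (by rwa [show n - 1 = j by omega]) he
    have hi : iotaP3 G ≤ (n + 2) / 5 := by
      apply aux_iota G _ (fun j => f (min (5 * j + 3) (n - 1)))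
      intro a b c hab hbc hac ha hb hc'
      obtain ⟨a, han, rfl⟩ := hs a
      obtain ⟨b, hbn, rfl⟩ := hs b
      obtain ⟨c, hcn, rfl⟩ := hs c
      have key : ∀ x < n, (∀ j < (n + 2) / 5, f (min (5 * j + 3) (n - 1)) ≠ f x ∧
          ¬ G.Adj (f (min (5 * j + 3) (n - 1))) (f x)) →
          (x % 5 = 0 ∨ x % 5 = 1) ∨ (x % 5 = 2 ∧ x + 1 = n ∧ n % 5 ≠ 3) := by
        intro x hx h
        by_contra! hcon
        have hh := h (x / 5) (by omega)
        by_cases h3 : min (5 * (x / 5) + 3) (n - 1) = x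
        · exact hh.1 (by rw [h3])
        by_cases h2 : x % 5 = 2
        · have := (hf.2 x (by omega)).symm
          rw [show x + 1 = min (5 * (x / 5) + 3) (n - 1) by omega] at this
          exact hh.2 this
        · have := (hf.2 (x - 1) (by omega))
          rw [show x - 1 + 1 = x by omega,
            show x - 1 = min (5 * (x / 5) + 3) (n - 1) by omega] at this
          exact hh.2 this
      have ka := key a han ha
      have kb := key b hbn hb
      have kc := key c hcn hc'
      have hac' : a ≠ c := fun h => hac (by rw [h])
      have hab' : a ≠ b := fun h => hab.ne (by rw [h])
      have hbc' : b ≠ c := fun h => hbc.ne (by rw [h])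
      have a1 := fun h => hA' a b h hbn hab
      have a2 := fun h => hA' b a h han hab.symm
      have a3 := fun h => hA' b c h hcn hbc
      have a4 := fun h => hA' c b h hbn hbc.symm
      omega
    exact ⟨by omega, fun h => by omega⟩
end
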